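/- Let G be a finite group acting 2-transitively on Ω, 𝒟 the set of derangements, π = χ₀ + ψ the permutation character with χ₀ trivial. If χ* is an irreducible character of G with χ* ≠ ψ such that λ(χ*) = χ*(𝒟)/χ*(1) is the minimum eigenvalue of the derangement graph Γ_G, then χ*(1) ≤ (|Ω|-1) · √(|G|/|𝒟| - 2). -/

import Mathlib

open Finset

open scoped ComplexOrder in
/-- Weyl's unitary trick: complex characters of a finite group satisfy `χ(g⁻¹) = conj χ(g)`. -/
theorem FDRep.character_inv_eq_star {G : Type} [Group G] [Fintype G] (V : FDRep ℂ G) (g : G) :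
    V.character g⁻¹ = star (V.character g) := by
  classical
  let b := Module.finBasis ℂ V
  let R : G → Matrix _ _ ℂ := fun g => LinearMap.toMatrix b b (V.ρ g)
  have hmul (x y : G) : R (x * y) = R x * R y := by
    simp only [R, map_mul, LinearMap.toMatrix_mul]
  have hone : R 1 = 1 := by simp only [R, map_one, LinearMap.toMatrix_one]
  have hchar (x : G) : V.character x = (R x).trace := LinearMap.trace_eq_matrix_trace ℂ b _
  let M := ∑ x : G, (R x).conjTranspose * R x
  have hpos : M.PosDef := by
    have hM : M = 1 + ∑ x ∈ univ.erase (1 : G), (R x).conjTranspose * R x := by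
      simp only [M]
      rw [← add_sum_erase univ _ (mem_univ (1 : G))]
      simp [hone]
    rw [hM]
    exact Matrix.PosDef.one.add_posSemidef
      (Matrix.posSemidef_sum _ fun x _ => Matrix.posSemidef_conjTranspose_mul_self _)
  have hinv : (R g).conjTranspose * M * R g = M := by
    simp only [M, mul_sum, sum_mul]
    refine Fintype.sum_equiv (Equiv.mulRight g) _ _ fun x => ?_
    simp [hmul, Matrix.conjTranspose_mul, Matrix.mul_assoc]
  have hgg : R g * R g⁻¹ = 1 := by rw [← hmul, mul_inv_cancel, hone]
  have hunit : IsUnit M.det := (Matrix.isUnit_iff_isUnit_det _).mp hpos.isUnit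
  have hconj : M * R g⁻¹ = (R g).conjTranspose * M := by
    conv_lhs => rw [← hinv]
    rw [Matrix.mul_assoc, hgg, Matrix.mul_one]
  rw [hchar, hchar, ← Matrix.trace_conjTranspose]
  calc (R g⁻¹).trace = (M⁻¹ * (M * R g⁻¹)).trace := by
        rw [Matrix.nonsing_inv_mul_cancel_left _ _ hunit]
    _ = (R g).conjTranspose.trace := by
        rw [hconj, Matrix.trace_mul_comm, Matrix.mul_assoc, Matrix.mul_nonsing_inv _ hunit,
          Matrix.mul_one]

/-- The linear permutation representation on functions on `Ω`. -/
noncomputable def functionRep (G Ω : Type) [Group G] [MulAction G Ω] :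
    Representation ℂ G (Ω → ℂ) where
  toFun g := LinearMap.funLeft ℂ ℂ (fun ω : Ω => g⁻¹ • ω)
  map_one' := by ext; simp [LinearMap.funLeft]
  map_mul' x y := by ext; simp [LinearMap.funLeft, mul_smul]

theorem character_functionRep {G Ω : Type} [Group G] [Fintype Ω] [DecidableEq Ω] [MulAction G Ω]
    (g : G) : (FDRep.of (functionRep G Ω)).character g = (#{ω : Ω | g • ω = ω} : ℂ) := by
  change LinearMap.trace ℂ (Ω → ℂ) (functionRep G Ω g) = _
  rw [LinearMap.trace_eq_matrix_trace ℂ (Pi.basisFun ℂ Ω), Matrix.trace, card_filter]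
  push_cast
  refine sum_congr rfl fun ω _ => ?_
  simp [functionRep, LinearMap.funLeft, Pi.single_apply, inv_smul_eq_iff, eq_comm (a := ω)]

/-- Burnside's count for a single orbit, given as a finite set of points. -/
theorem sum_card_fixing_eq_card {G X : Type} [Group G] [Fintype G] [DecidableEq X] [MulAction G X]
    (S : Finset X) (hne : S.Nonempty) (hinv : ∀ (g : G), ∀ s ∈ S, g • s ∈ S)
    (htrans : ∀ s ∈ S, ∀ t ∈ S, ∃ g : G, g • s = t) :
    ∑ s ∈ S, #{g : G | g • s = s} = Fintype.card G := by
  obtain ⟨s₀, hs₀⟩ := hne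
  rw [← card_univ, card_eq_sum_card_fiberwise (f := fun g : G => g • s₀) (t := S)
    (fun g _ => hinv g s₀ hs₀)]
  refine sum_congr rfl fun s hs => ?_
  obtain ⟨k, rfl⟩ := htrans s₀ hs₀ s hs
  refine card_bij (fun g _ => g * k) ?_ ?_ ?_
  · simp [mul_smul]
  · simp
  · intro g hg
    refine ⟨g * k⁻¹, ?_, by simp⟩
    simpa [mul_smul] using hg

section TwoTransitive

variable {G Ω : Type} [Group G] [Fintype Ω] [MulAction G Ω]

theorem exists_smul_eq_of_twoTransitive (hcard : 2 ≤ Fintype.card Ω)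
    (h2 : ∀ a b c d : Ω, a ≠ b → c ≠ d → ∃ g : G, g • a = c ∧ g • b = d) (a c : Ω) :
    ∃ g : G, g • a = c := by
  have : Nontrivial Ω := Fintype.one_lt_card_iff_nontrivial.mp hcard
  obtain ⟨b, hb⟩ := exists_ne a
  obtain ⟨d, hd⟩ := exists_ne c
  obtain ⟨g, hg, -⟩ := h2 a b c d hb.symm hd.symm
  exact ⟨g, hg⟩

variable [Fintype G] [DecidableEq Ω]

theorem sum_card_fixedPoints (hcard : 2 ≤ Fintype.card Ω)
    (h2 : ∀ a b c d : Ω, a ≠ b → c ≠ d → ∃ g : G, g • a = c ∧ g • b = d) :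
    ∑ g : G, #{ω : Ω | g • ω = ω} = Fintype.card G := by
  have : Nonempty Ω := Fintype.card_pos_iff.mp (by lia)
  rw [← sum_card_fixing_eq_card (G := G) (univ : Finset Ω) univ_nonempty (by simp)
    fun a _ c _ => exists_smul_eq_of_twoTransitive hcard h2 a c]
  simp only [card_filter]
  exact sum_comm

theorem sum_card_fixedPoints_sq (hcard : 2 ≤ Fintype.card Ω)
    (h2 : ∀ a b c d : Ω, a ≠ b → c ≠ d → ∃ g : G, g • a = c ∧ g • b = d) :
    ∑ g : G, #{ω : Ω | g • ω = ω} ^ 2 = 2 * Fintype.card G := by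
  have : Nontrivial Ω := Fintype.one_lt_card_iff_nontrivial.mp hcard
  have hoff := sum_card_fixing_eq_card (G := G) (univ : Finset Ω).offDiag
    (by
      obtain ⟨a, b, hab⟩ := exists_pair_ne Ω
      exact ⟨(a, b), by simpa using hab⟩) (by simp)
    (by
      rintro ⟨a, b⟩ hab ⟨c, d⟩ hcd
      obtain ⟨g, hg⟩ := h2 a b c d (by simpa using hab) (by simpa using hcd)
      exact ⟨g, Prod.ext hg.1 hg.2⟩)
  have hsq (g : G) : #{ω : Ω | g • ω = ω} ^ 2 =
      #{ω : Ω | g • ω = ω} + #{p ∈ (univ : Finset Ω).offDiag | g • p = p} := by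
    rw [sq, ← card_product, ← diag_union_offDiag, card_union_of_disjoint (disjoint_diag_offDiag _),
      diag_card]
    congr 2
    ext p
    simp [Prod.ext_iff]
    tauto
  simp only [hsq, sum_add_distrib, sum_card_fixedPoints hcard h2, two_mul]
  congr 1
  rw [← hoff]
  simp only [card_filter]
  exact sum_comm

/-- In a 2-transitive action, the derangements are equidistributed over the maps `a ↦ b`,
`b ≠ a`. -/
theorem card_derangements_mapping [DecidableEq G] (hcard : 2 ≤ Fintype.card Ω)
    (h2 : ∀ a b c d : Ω, a ≠ b → c ≠ d → ∃ g : G, g • a = c ∧ g • b = d)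
    (D : Finset G) (hD : D = univ.filter (fun g : G => ∀ ω : Ω, g • ω ≠ ω)) (a b : Ω) :
    (#{d ∈ D | d • a = b} : ℝ) =
      if b = a then 0 else (#D : ℝ) / ((Fintype.card Ω : ℝ) - 1) := by
  split_ifs with hba
  · subst hba
    simp +contextual [hD]
  have hconst (c : Ω) (hc : c ≠ a) : #{d ∈ D | d • a = c} = #{d ∈ D | d • a = b} := by
    obtain ⟨k, hka, hkc⟩ := h2 a c a b hc.symm (Ne.symm hba)
    have hka' : k⁻¹ • a = a := by rw [inv_smul_eq_iff, hka]
    have hbk : k⁻¹ • b = c := by rw [inv_smul_eq_iff, hkc]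
    refine card_bij (fun d _ => k * d * k⁻¹) ?_ ?_ ?_
    · intro d hd
      simp only [hD, mem_filter, mem_univ, true_and] at hd ⊢
      refine ⟨fun ω h => hd.1 (k⁻¹ • ω) ?_, ?_⟩
      · rw [eq_inv_smul_iff]
        simpa [mul_smul] using h
      · rw [mul_smul, mul_smul, hka', hd.2, hkc]
    · simp
    · intro d hd
      simp only [hD, mem_filter, mem_univ, true_and] at hd
      refine ⟨k⁻¹ * d * k, ?_, by group⟩
      simp only [hD, mem_filter, mem_univ, true_and]
      refine ⟨fun ω h => hd.1 (k • ω) ?_, ?_⟩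
      · rw [mul_smul, mul_smul, inv_smul_eq_iff] at h
        exact h
      · rw [mul_smul, mul_smul, hka, hd.2, hbk]
  have hzero : #{d ∈ D | d • a = a} = 0 := by
    simp +contextual [hD]
  have hsum : #D = (Fintype.card Ω - 1) * #{d ∈ D | d • a = b} := by
    rw [card_eq_sum_card_fiberwise (f := fun d : G => d • a) (t := (univ : Finset Ω)) (by simp),
      ← add_sum_erase univ _ (mem_univ a), hzero, zero_add,
      sum_congr rfl fun c hc => hconst c (ne_of_mem_erase hc)]
    simp
  have hn : (2 : ℝ) ≤ Fintype.card Ω := by exact_mod_cast hcard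
  rw [eq_div_iff (by linarith), hsum]
  push_cast [Nat.cast_sub (by lia : 1 ≤ Fintype.card Ω)]
  ring

theorem neg_card_div_mem_spectrum [DecidableEq G] (hcard : 2 ≤ Fintype.card Ω)
    (h2 : ∀ a b c d : Ω, a ≠ b → c ≠ d → ∃ g : G, g • a = c ∧ g • b = d)
    (D : Finset G) (hD : D = univ.filter (fun g : G => ∀ ω : Ω, g • ω ≠ ω))
    (A : Matrix G G ℝ) (hA : ∀ g h : G, A g h = if g * h⁻¹ ∈ D then 1 else 0) :
    -((#D : ℝ) / ((Fintype.card Ω : ℝ) - 1)) ∈ spectrum ℝ A := by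
  obtain ⟨a⟩ : Nonempty Ω := Fintype.card_pos_iff.mp (by lia)
  have hn : (2 : ℝ) ≤ Fintype.card Ω := by exact_mod_cast hcard
  have hn1 : (Fintype.card Ω : ℝ) - 1 ≠ 0 := by linarith
  rw [← Matrix.spectrum_toLin', ← Module.End.hasEigenvalue_iff_mem_spectrum]
  let v : G → ℝ := fun h => (if h • a = a then 1 else 0) - 1 / (Fintype.card Ω : ℝ)
  refine Module.End.hasEigenvalue_of_hasEigenvector (x := v)
    ⟨Module.End.mem_eigenspace_iff.mpr ?_, fun h => ?_⟩
  · ext g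
    have hcount : (A.mulVec v) g = ∑ d ∈ D, v (d⁻¹ * g) := by
      simp only [Matrix.mulVec, dotProduct, hA, ite_mul, one_mul, zero_mul]
      rw [← sum_filter]
      refine sum_bij (fun h _ => g * h⁻¹) ?_ ?_ ?_ ?_
      · simp
      · simp
      · exact fun d hd => ⟨d⁻¹ * g, by simpa using hd, by group⟩
      · intro h _
        congr 1
        group
    have hfix : ∑ d ∈ D, (if (d⁻¹ * g) • a = a then (1 : ℝ) else 0) =
        #{d ∈ D | d • a = g • a} := by
      rw [card_filter]
      push_cast
      refine sum_congr rfl fun d _ => ?_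
      simp [mul_smul, inv_smul_eq_iff, eq_comm (a := g • a)]
    rw [Matrix.toLin'_apply, hcount]
    simp only [v, sum_sub_distrib, hfix, card_derangements_mapping hcard h2 D hD a,
      Pi.smul_apply, smul_eq_mul, sum_const, nsmul_eq_mul]
    split_ifs <;> field_simp <;> ring
  · have h1 := congrFun h 1
    simp only [v, one_smul, if_true, Pi.zero_apply] at h1
    field_simp at h1
    simp [hn1] at h1

end TwoTransitive

/-- A real function of norm one whose inner product with an irreducible character `χ` is a
natural number is either orthogonal to `χ` or equal to it. -/
theorem sum_re_character_mul_eq_zero {G : Type} [Group G] [Fintype G] (V : FDRep ℂ G)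
    (hV : ∑ g, ((V.character g).re ^ 2 + (V.character g).im ^ 2) = Fintype.card G)
    (φ : G → ℝ) (hφ : ∑ g, φ g ^ 2 = Fintype.card G) (m : ℕ)
    (hm : ∑ g, (V.character g).re * φ g = Fintype.card G * m)
    (hne : V.character ≠ fun g => (φ g : ℂ)) :
    ∑ g, (V.character g).re * φ g = 0 := by
  have hdist : ∑ g, (((V.character g).re - φ g) ^ 2 + (V.character g).im ^ 2) =
      2 * Fintype.card G * (1 - m) := by
    calc _ = ∑ g, (((V.character g).re ^ 2 + (V.character g).im ^ 2) + φ g ^ 2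
            - 2 * ((V.character g).re * φ g)) := sum_congr rfl fun g _ => by ring
      _ = _ := by
        rw [sum_sub_distrib, sum_add_distrib, ← mul_sum, hV, hφ, hm]
        ring
  have hpos : 0 < ∑ g, (((V.character g).re - φ g) ^ 2 + (V.character g).im ^ 2) := by
    obtain ⟨g, hg⟩ := Function.ne_iff.mp hne
    refine sum_pos' (fun g _ => by positivity) ⟨g, mem_univ g, ?_⟩
    by_contra! h
    refine hg (Complex.ext ?_ ?_)
    · rw [Complex.ofReal_re]
      nlinarith [sq_nonneg ((V.character g).re - φ g), sq_nonneg (V.character g).im]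
    · rw [Complex.ofReal_im]
      nlinarith [sq_nonneg ((V.character g).re - φ g), sq_nonneg (V.character g).im]
  have hN : (0 : ℝ) < Fintype.card G := by exact_mod_cast Fintype.card_pos
  have hm1 : (m : ℝ) < 1 := by
    rw [hdist] at hpos
    nlinarith
  have hm0 : m = 0 := by
    have : m < 1 := by exact_mod_cast hm1
    lia
  simpa [hm0] using hm

/-- Bessel's inequality for the indicator function of `D` and three orthogonal real functions,
one of which is constant. -/
theorem bessel_indicator {G : Type} [Fintype G] [Nonempty G] [DecidableEq G] (D : Finset G)
    (ψ r : G → ℝ) (hψ0 : ∑ g, ψ g = 0) (hψ : ∑ g, ψ g ^ 2 = Fintype.card G)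
    (hr0 : ∑ g, r g = 0) (hrψ : ∑ g, r g * ψ g = 0) (hr : ∑ g, r g ^ 2 ≤ Fintype.card G) :
    (#D : ℝ) ^ 2 + (∑ g ∈ D, ψ g) ^ 2 + (∑ g ∈ D, r g) ^ 2 ≤ Fintype.card G * #D := by
  have hN : (0 : ℝ) < Fintype.card G := by exact_mod_cast Fintype.card_pos
  set N := (Fintype.card G : ℝ)
  set P := ∑ g ∈ D, ψ g
  set S := ∑ g ∈ D, r g
  let f : G → ℝ := fun g => if g ∈ D then 1 else 0
  have hf : ∑ g, f g = #D := by simp [f]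
  have hfψ : ∑ g, f g * ψ g = P := by simp [f, P]
  have hfr : ∑ g, f g * r g = S := by simp [f, S]
  have hff (g : G) : f g ^ 2 = f g := by by_cases h : g ∈ D <;> simp [f, h]
  have hexp : ∑ g, (N * f g - #D - P * ψ g - S * r g) ^ 2 =
      N ^ 2 * #D - N * #D ^ 2 - N * P ^ 2 - 2 * N * S ^ 2 + S ^ 2 * ∑ g, r g ^ 2 := by
    calc _ = ∑ g, (N ^ 2 * f g + (#D : ℝ) ^ 2 + P ^ 2 * ψ g ^ 2 + S ^ 2 * r g ^ 2
          - 2 * N * #D * f g - 2 * N * P * (f g * ψ g) - 2 * N * S * (f g * r g)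
          + 2 * #D * P * ψ g + 2 * #D * S * r g + 2 * P * S * (r g * ψ g)) :=
          sum_congr rfl fun g _ => by
            linear_combination N ^ 2 * hff g
      _ = _ := by
        simp only [sum_add_distrib, sum_sub_distrib, ← mul_sum, hf, hfψ, hfr, hψ0, hψ, hr0, hrψ,
          sum_const, card_univ, nsmul_eq_mul]
        ring
  have hnonneg : 0 ≤ ∑ g, (N * f g - #D - P * ψ g - S * r g) ^ 2 :=
    sum_nonneg fun g _ => sq_nonneg _
  rw [hexp] at hnonneg
  have hS := mul_le_mul_of_nonneg_left hr (sq_nonneg S)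
  refine le_of_mul_le_mul_left ?_ hN
  nlinarith


theorem degree_bound_of_min_eigenvalue
    {G : Type} [Group G] [Fintype G] [DecidableEq G]
    {Ω : Type} [Fintype Ω] [DecidableEq Ω] [MulAction G Ω]
    (hcard : 2 ≤ Fintype.card Ω)
    (h2 : ∀ a b c d : Ω, a ≠ b → c ≠ d → ∃ g : G, g • a = c ∧ g • b = d)
    (D : Finset G) (hD : D = Finset.univ.filter (fun g : G => ∀ ω : Ω, g • ω ≠ ω))
    (hDne : D.Nonempty)
    (A : Matrix G G ℝ)
    (hA : ∀ g h : G, A g h = if g * h⁻¹ ∈ D then 1 else 0)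
    (V : FDRep ℂ G) (hsimple : CategoryTheory.Simple V)
    (hne : V.character ≠ fun g =>
      ((Finset.univ.filter (fun ω : Ω => g • ω = ω)).card : ℂ) - 1)
    (lam : ℝ)
    (hlam : (lam : ℂ) * V.character 1 = ∑ g ∈ D, V.character g)
    (hspec : lam ∈ spectrum ℝ A)
    (hmin : ∀ μ ∈ spectrum ℝ A, lam ≤ μ) :
    (V.character 1).re ≤ ((Fintype.card Ω : ℝ) - 1) *
      Real.sqrt ((Fintype.card G : ℝ) / (D.card : ℝ) - 2) := by
  have hinvN : Invertible (Nat.card G : ℂ) := invertibleOfNonzero (by simp)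
  have hN0 : (Nat.card G : ℂ) ≠ 0 := by simp
  have hn : (2 : ℝ) ≤ Fintype.card Ω := by exact_mod_cast hcard
  have hDpos : (0 : ℝ) < #D := by exact_mod_cast hDne.card_pos
  have hlam_le := hmin _ (neg_card_div_mem_spectrum hcard h2 D hD A hA)
  have hquot : 0 < (#D : ℝ) / ((Fintype.card Ω : ℝ) - 1) := div_pos hDpos (by linarith)
  let ψ : G → ℝ := fun g => (#{ω : Ω | g • ω = ω} : ℝ) - 1
  have hπ1 : ∑ g : G, (#{ω : Ω | g • ω = ω} : ℝ) = Fintype.card G := by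
    exact_mod_cast sum_card_fixedPoints (G := G) hcard h2
  have hπ2 : ∑ g : G, (#{ω : Ω | g • ω = ω} : ℝ) ^ 2 = 2 * Fintype.card G := by
    exact_mod_cast sum_card_fixedPoints_sq (G := G) hcard h2
  have hψ0 : ∑ g, ψ g = 0 := by simp [ψ, sum_sub_distrib, hπ1]
  have hψ2 : ∑ g, ψ g ^ 2 = Fintype.card G := by
    simp only [ψ, sub_sq, sum_add_distrib, sum_sub_distrib, mul_one, one_pow, ← mul_sum, hπ1, hπ2,
      sum_const, card_univ, nsmul_eq_mul]
    ring
  have hψD : ∑ g ∈ D, ψ g = -#D := by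
    have hval : ∀ g ∈ D, ψ g = -1 := by
      intro g hg
      simp only [hD, mem_filter, mem_univ, true_and] at hg
      simp [ψ, hg]
    simp [sum_congr rfl hval]
  have hχ : ∑ g, ((V.character g).re ^ 2 + (V.character g).im ^ 2) = Fintype.card G := by
    have h := congrArg Complex.re ((FDRep.simple_iff_char_is_norm_one V).mp hsimple)
    simpa [FDRep.character_inv_eq_star, Complex.mul_re, sq] using h
  have hchi_one : V.character ≠ fun _ => ((1 : ℝ) : ℂ) := by
    intro h
    have h' : lam = #D := by
      simp only [h, Complex.ofReal_one, mul_one, sum_const, nsmul_eq_mul] at hlam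
      exact_mod_cast hlam
    linarith
  have hχ0 : ∑ g, (V.character g).re = 0 := by
    have h := FDRep.average_char_eq_finrank_invariants V
    rw [inv_mul_eq_iff_eq_mul₀ hN0] at h
    replace h := congrArg Complex.re h
    have h0 := sum_re_character_mul_eq_zero V hχ (fun _ => 1) (by simp) _
      (by simpa using h) hchi_one
    simpa using h0
  have hχψ : ∑ g, (V.character g).re * ψ g = 0 := by
    have h := FDRep.scalar_product_char_eq_finrank_equivariant V (FDRep.of (functionRep G Ω))
    rw [inv_mul_eq_iff_eq_mul₀ hN0] at h
    replace h := congrArg Complex.re h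
    simp only [character_functionRep, FDRep.character_inv_eq_star] at h
    refine sum_re_character_mul_eq_zero V hχ ψ hψ2
      (Module.finrank ℂ (V ⟶ FDRep.of (functionRep G Ω))) ?_ (by simpa [ψ] using hne)
    simp only [ψ, mul_sub, mul_one, sum_sub_distrib, hχ0, sub_zero]
    simpa [mul_comm] using h
  have hχD : ∑ g ∈ D, (V.character g).re = lam * (V.character 1).re := by
    have h := congrArg Complex.re hlam
    simpa using h.symm
  have hχre : ∑ g, (V.character g).re ^ 2 ≤ Fintype.card G := by
    rw [← hχ]
    exact sum_le_sum fun g _ => by nlinarith [sq_nonneg (V.character g).im]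
  have hbessel := bessel_indicator D ψ (fun g => (V.character g).re) hψ0 hψ2 hχ0 hχψ hχre
  rw [hψD, hχD] at hbessel
  set d := (V.character 1).re
  set n := (Fintype.card Ω : ℝ)
  set N := (Fintype.card G : ℝ)
  have hlam_sq : (#D / (n - 1)) ^ 2 ≤ lam ^ 2 := by nlinarith
  have hkey : (d / (n - 1)) ^ 2 ≤ N / #D - 2 := by
    refine le_of_mul_le_mul_left ?_ (sq_pos_of_pos hDpos)
    calc (#D : ℝ) ^ 2 * (d / (n - 1)) ^ 2 = (#D / (n - 1)) ^ 2 * d ^ 2 := by ring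
      _ ≤ lam ^ 2 * d ^ 2 := mul_le_mul_of_nonneg_right hlam_sq (sq_nonneg d)
      _ ≤ N * #D - 2 * (#D : ℝ) ^ 2 := by nlinarith
      _ = (#D : ℝ) ^ 2 * (N / #D - 2) := by field_simp
  have h := Real.le_sqrt_of_sq_le hkey
  rw [div_le_iff₀ (by linarith)] at h
  linarith
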